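/- arXiv:2203.06623 — 2 statements merged into one kernel-verified Lean document; each statement's English description precedes it below -/
import Mathlib

section
/- Let α > 0, let γ satisfy 0 < γ < min(1, α), let u_0 ∈ ℝ, and let f : {p^k : k ∈ ℤ} × ℝ → ℝ satisfy |f(r, x)| ≤ M and |f(r, x) − f(r, y)| ≤ F |x − y| for all r and all x, y ∈ ℝ. Define radial functions u_k recursively by u_0(|t|_p) ≡ u_0 and u_k(|t|_p) = u_0 + (I^α [ f̃(|·|_p, u_{k−1}(|·|_p)) ])(|t|_p) for k ≥ 1. Then every u_k is well defined for all t ≠ 0 (all relevant integrals converge absolutely), and there exists a constant C > 0 depending only on p, α, γ such that for all integers k ≥ 0 and all t ≠ 0: |u_{k+1}(|t|_p) − u_k(|t|_p)| ≤ C^{k+1} M F^{k} |t|_p^{(k+1)(α−γ)}. -/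
open MeasureTheory Metric

noncomputable section

variable (p : ℕ) [Fact p.Prime]

instance : MeasurableSpace ℚ_[p] := borel _
instance : BorelSpace ℚ_[p] := ⟨rfl⟩

/-- The closed unit ball of `ℚ_[p]` as a positive compact set. -/
def unitBallPC : TopologicalSpace.PositiveCompacts ℚ_[p] where
  carrier := closedBall 0 1
  isCompact' := isCompact_closedBall 0 1
  interior_nonempty' := ⟨0, mem_interior_iff_mem_nhds.2
    (Filter.mem_of_superset (ball_mem_nhds 0 one_pos) ball_subset_closedBall)⟩

/-- The Haar measure on `ℚ_[p]` normalized so the unit ball has measure 1. -/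
def padicHaar : Measure ℚ_[p] := Measure.addHaarMeasure (unitBallPC p)

/-- A point on the sphere of radius `p^k`. -/
def sph (k : ℤ) : ℚ_[p] := (p : ℚ_[p]) ^ (-k)

/-- A function is radial if it depends only on the p-adic absolute value. -/
def Radial (u : ℚ_[p] → ℝ) : Prop := ∀ x y : ℚ_[p], ‖x‖ = ‖y‖ → u x = u y

/-- The integrand of the Vladimirov operator `D^α` at `x`. -/
def Dker (α : ℝ) (u : ℚ_[p] → ℝ) (x : ℚ_[p]) : ℚ_[p] → ℝ :=
  fun y => ‖y‖ ^ (-α - 1) * (u (x - y) - u x)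

/-- The Vladimirov fractional differentiation operator. -/
def Dop (α : ℝ) (u : ℚ_[p] → ℝ) (x : ℚ_[p]) : ℝ :=
  ((1 - (p : ℝ) ^ α) / (1 - (p : ℝ) ^ (-α - 1))) * ∫ y, Dker p α u x y ∂(padicHaar p)

/-- The kernel of the fractional integral `I^α`. -/
def Iker (α : ℝ) (x y : ℚ_[p]) : ℝ :=
  if α = 1 then Real.log ‖x - y‖ - Real.log ‖y‖
  else ‖x - y‖ ^ (α - 1) - ‖y‖ ^ (α - 1)

/-- The constant in front of the fractional integral. -/
def Icoef (α : ℝ) : ℝ :=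
  if α = 1 then (1 - (p : ℝ)) / (p * Real.log p)
  else (1 - (p : ℝ) ^ (-α)) / (1 - (p : ℝ) ^ (α - 1))

/-- The p-adic fractional integral `I^α`. -/
def Iop (α : ℝ) (u : ℚ_[p] → ℝ) (x : ℚ_[p]) : ℝ :=
  Icoef p α * ∫ y in {y : ℚ_[p] | ‖y‖ ≤ ‖x‖}, Iker p α x y * u y ∂(padicHaar p)

end

instance (p : ℕ) [Fact p.Prime] : (padicHaar p).IsAddHaarMeasure := by
  unfold padicHaar; infer_instance

lemma haar_ball_succ (p : ℕ) [Fact p.Prime] (k : ℤ) :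
    padicHaar p (closedBall 0 ((p : ℝ) ^ (k + 1))) = p * padicHaar p (closedBall 0 ((p : ℝ) ^ k)) := by
  have hp : (p : ℝ) ≠ 0 := by exact_mod_cast (Fact.out : p.Prime).ne_zero
  have hp0 : (0:ℝ) < p := by exact_mod_cast (Fact.out : p.Prime).pos
  have hpp : (p : ℚ_[p]) ≠ 0 := by exact_mod_cast (Fact.out : p.Prime).ne_zero
  have hset : closedBall (0 : ℚ_[p]) ((p : ℝ) ^ (k + 1)) =
      ⋃ i ∈ Finset.range p, closedBall ((p : ℚ_[p]) ^ (-(k+1)) * (i : ℚ_[p])) ((p : ℝ) ^ k) := by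
    ext y
    simp only [mem_closedBall, dist_zero_right, Set.mem_iUnion, Finset.mem_range, exists_prop]
    constructor
    · intro hy
      have hz : ‖(p : ℚ_[p]) ^ (k+1) * y‖ ≤ 1 := by
        rw [norm_mul, Padic.norm_p_zpow, zpow_neg]
        rw [inv_mul_le_iff₀ (by positivity)]; simpa using hy
      obtain ⟨z, hzz⟩ : ∃ z : ℤ_[p], (z : ℚ_[p]) = (p : ℚ_[p]) ^ (k+1) * y := ⟨⟨_, hz⟩, rfl⟩
      obtain ⟨i, hi, hm⟩ := PadicInt.exists_mem_range z
      refine ⟨i, hi, ?_⟩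
      rw [PadicInt.maximalIdeal_eq_span_p, ← pow_one (p : ℤ_[p]), ← PadicInt.norm_le_pow_iff_mem_span_pow] at hm
      rw [PadicInt.norm_def, PadicInt.coe_sub, PadicInt.coe_natCast, hzz] at hm
      have h3 : y - (p : ℚ_[p]) ^ (-(k+1)) * (i : ℚ_[p]) = (p : ℚ_[p]) ^ (-(k+1)) * ((p : ℚ_[p]) ^ (k+1) * y - i) := by
        rw [mul_sub, ← mul_assoc, ← zpow_add₀ hpp]; simp
      rw [dist_eq_norm, h3, norm_mul, Padic.norm_p_zpow, neg_neg]
      calc (p : ℝ) ^ (k+1) * ‖(p : ℚ_[p]) ^ (k+1) * y - i‖ ≤ (p : ℝ) ^ (k+1) * (p : ℝ) ^ (-1 : ℤ) := by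
            gcongr; simpa using hm
        _ = _ := by rw [← zpow_add₀ hp]; simp
    · rintro ⟨i, hi, h⟩
      have h1 : ‖(p : ℚ_[p]) ^ (-(k+1)) * (i : ℚ_[p])‖ ≤ (p : ℝ) ^ (k+1) := by
        rw [norm_mul, Padic.norm_p_zpow, neg_neg]
        refine mul_le_of_le_one_right (by positivity) ?_
        exact_mod_cast Padic.norm_int_le_one (p := p) (i : ℤ)
      have h2 : (p : ℝ) ^ k ≤ (p : ℝ) ^ (k+1) :=
        zpow_le_zpow_right₀ (by exact_mod_cast (Fact.out : p.Prime).one_le) (by omega)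
      rw [dist_eq_norm] at h
      have := IsUltrametricDist.norm_add_le_max (y - (p : ℚ_[p]) ^ (-(k+1)) * (i : ℚ_[p])) ((p : ℚ_[p]) ^ (-(k+1)) * (i : ℚ_[p]))
      rw [sub_add_cancel] at this
      exact this.trans (max_le (h.trans h2) h1)
  rw [hset, measure_biUnion_finset]
  · have : ∀ a : ℚ_[p], padicHaar p (closedBall a ((p : ℝ) ^ k)) = padicHaar p (closedBall 0 ((p : ℝ) ^ k)) := by
      intro a
      exact Measure.addHaar_closedBall_center _ _ _
    simp [this]
  · intro i hi j hj hij
    simp only [Finset.coe_range, Set.mem_Iio] at hi hj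
    rw [Function.onFun, Set.disjoint_left]
    intro y hy hy'
    rw [mem_closedBall, dist_eq_norm] at hy hy'
    have h1 := IsUltrametricDist.norm_add_le_max (y - (p : ℚ_[p]) ^ (-(k+1)) * (j : ℚ_[p])) (-(y - (p : ℚ_[p]) ^ (-(k+1)) * (i : ℚ_[p])))
    rw [norm_neg, ← sub_eq_add_neg] at h1
    have h2 := h1.trans (max_le hy' hy)
    have h3 : y - (p : ℚ_[p]) ^ (-(k+1)) * (j : ℚ_[p]) - (y - (p : ℚ_[p]) ^ (-(k+1)) * (i : ℚ_[p])) = (p : ℚ_[p]) ^ (-(k+1)) * (((i : ℤ) - (j : ℤ) : ℤ) : ℚ_[p]) := by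
      push_cast; ring
    rw [h3, norm_mul, Padic.norm_p_zpow, neg_neg] at h2
    have h4 : ‖(((i : ℤ) - (j : ℤ) : ℤ) : ℚ_[p])‖ < 1 := by
      by_contra hcon
      push Not at hcon
      have h5 : (p : ℝ) ^ k < (p : ℝ) ^ (k+1) :=
        zpow_lt_zpow_right₀ (by exact_mod_cast (Fact.out : p.Prime).one_lt) (by omega)
      have : (p : ℝ) ^ (k+1) * 1 ≤ (p : ℝ) ^ (k+1) * ‖(((i : ℤ) - (j : ℤ) : ℤ) : ℚ_[p])‖ := by gcongr
      linarith
    rw [Padic.norm_intCast_lt_one_iff] at h4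
    apply hij
    have := Int.eq_zero_of_abs_lt_dvd h4 (by rw [abs_lt]; omega)
    omega
  · intro i _
    exact measurableSet_closedBall

lemma haar_ball (p : ℕ) [Fact p.Prime] (k : ℤ) :
    padicHaar p (closedBall 0 ((p : ℝ) ^ k)) = ENNReal.ofReal ((p : ℝ) ^ k) := by
  have hp : (p : ℝ) ≠ 0 := by exact_mod_cast (Fact.out : p.Prime).ne_zero
  have key : ∀ k : ℤ, ENNReal.ofReal ((p : ℝ) ^ (k+1)) = p * ENNReal.ofReal ((p : ℝ) ^ k) := by
    intro k
    rw [zpow_add_one₀ hp, mul_comm, ENNReal.ofReal_mul (by positivity)]; simp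
  induction k using Int.induction_on with
  | zero =>
    simp only [zpow_zero, ENNReal.ofReal_one]
    exact Measure.addHaarMeasure_self (K₀ := unitBallPC p)
  | succ i ih => rw [haar_ball_succ, key, ih]
  | pred i ih =>
    have h1 := haar_ball_succ p (-(i:ℤ) - 1)
    have h2 := key (-(i:ℤ) - 1)
    rw [sub_add_cancel] at h1 h2
    rw [ih, h2] at h1
    exact ((ENNReal.mul_right_inj (by exact_mod_cast (Fact.out : p.Prime).ne_zero) (by simp)).1 h1).symm

lemma lint_rpow (p : ℕ) [Fact p.Prime] (s : ℝ) (hs : -1 < s) :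
    ∃ K : NNReal, ∀ t : ℚ_[p], t ≠ 0 →
      ∫⁻ y in {y : ℚ_[p] | ‖y‖ ≤ ‖t‖}, ENNReal.ofReal (‖y‖ ^ s) ∂(padicHaar p) ≤
        K * ENNReal.ofReal (‖t‖ ^ (s + 1)) := by
  have hp1 : (1:ℝ) < p := by exact_mod_cast (Fact.out : p.Prime).one_lt
  have hp0 : (0:ℝ) < p := by linarith
  set q : ℝ := (p : ℝ) ^ (-(s + 1)) with hq
  have hq0 : 0 ≤ q := by positivity
  have hq1 : q < 1 := Real.rpow_lt_one_of_one_lt_of_neg hp1 (by linarith)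
  have hsum : Summable (fun n : ℕ => q ^ n) := summable_geometric_of_lt_one hq0 hq1
  refine ⟨(∑' n : ℕ, q ^ n).toNNReal, fun t ht => ?_⟩
  have hsub : {y : ℚ_[p] | ‖y‖ ≤ ‖t‖} ⊆ {0} ∪ ⋃ n : ℕ, {y : ℚ_[p] | ‖y‖ = ‖t‖ * (p : ℝ) ^ (-(n : ℤ))} := by
    intro y hy
    by_cases hy0 : y = 0
    · left; exact hy0
    · right
      simp only [Set.mem_ofPred_eq] at hy
      rw [Set.mem_iUnion]
      have hy' := hy
      rw [Padic.norm_eq_zpow_neg_valuation hy0, Padic.norm_eq_zpow_neg_valuation ht,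
        zpow_le_zpow_iff_right₀ hp1] at hy'
      refine ⟨(y.valuation - t.valuation).toNat, ?_⟩
      rw [Set.mem_ofPred_eq, Padic.norm_eq_zpow_neg_valuation hy0, Padic.norm_eq_zpow_neg_valuation ht,
        ← zpow_add₀ hp0.ne']
      congr 1; omega
  have hsph : ∀ n : ℕ, ∫⁻ y in {y : ℚ_[p] | ‖y‖ = ‖t‖ * (p : ℝ) ^ (-(n : ℤ))}, ENNReal.ofReal (‖y‖ ^ s) ∂(padicHaar p)
      ≤ ENNReal.ofReal (q ^ n * ‖t‖ ^ (s + 1)) := by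
    intro n
    have hm : MeasurableSet {y : ℚ_[p] | ‖y‖ = ‖t‖ * (p : ℝ) ^ (-(n : ℤ))} :=
      measurableSet_eq_fun measurable_norm measurable_const
    have htp : 0 < ‖t‖ := norm_pos_iff.2 ht
    rw [setLIntegral_congr_fun (g := fun _ => ENNReal.ofReal ((‖t‖ * (p : ℝ) ^ (-(n : ℤ))) ^ s)) hm
      (fun y hy => by simp only [Set.mem_ofPred_eq] at hy; simp only [hy])]
    rw [setLIntegral_const]
    have hmu : padicHaar p {y : ℚ_[p] | ‖y‖ = ‖t‖ * (p : ℝ) ^ (-(n : ℤ))} ≤ ENNReal.ofReal (‖t‖ * (p : ℝ) ^ (-(n : ℤ))) := by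
      have : ‖t‖ * (p : ℝ) ^ (-(n : ℤ)) = (p : ℝ) ^ (-t.valuation + -(n:ℤ)) := by
        rw [Padic.norm_eq_zpow_neg_valuation ht, ← zpow_add₀ hp0.ne']
      rw [this, ← haar_ball]
      apply measure_mono
      intro y hy
      simp only [Set.mem_ofPred_eq] at hy
      simp [hy]
    refine (mul_le_mul_right hmu _).trans ?_
    rw [← ENNReal.ofReal_mul (by positivity)]
    apply ENNReal.ofReal_le_ofReal
    apply le_of_eq
    have hr : 0 < ‖t‖ * (p : ℝ) ^ (-(n : ℤ)) := by positivity
    rw [← Real.rpow_add_one hr.ne', Real.mul_rpow htp.le (by positivity), mul_comm]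
    congr 1
    rw [hq, ← Real.rpow_natCast, ← Real.rpow_mul hp0.le, ← Real.rpow_intCast, ← Real.rpow_mul hp0.le]
    congr 1; push_cast; ring
  calc _ ≤ ∫⁻ y in {0} ∪ ⋃ n : ℕ, {y : ℚ_[p] | ‖y‖ = ‖t‖ * (p : ℝ) ^ (-(n : ℤ))}, ENNReal.ofReal (‖y‖ ^ s) ∂(padicHaar p) :=
        lintegral_mono_set hsub
    _ ≤ ∫⁻ y in ({0} : Set ℚ_[p]), ENNReal.ofReal (‖y‖ ^ s) ∂(padicHaar p) + ∫⁻ y in ⋃ n : ℕ, {y : ℚ_[p] | ‖y‖ = ‖t‖ * (p : ℝ) ^ (-(n : ℤ))}, ENNReal.ofReal (‖y‖ ^ s) ∂(padicHaar p) :=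
        lintegral_union_le _ _ _
    _ ≤ 0 + ∑' n : ℕ, ENNReal.ofReal (q ^ n * ‖t‖ ^ (s + 1)) := by
        gcongr
        · rw [setLIntegral_measure_zero _ _ (measure_singleton 0)]
        · exact (lintegral_iUnion_le _ _).trans (ENNReal.tsum_le_tsum hsph)
    _ = _ := by
        rw [zero_add, ← ENNReal.ofReal_tsum_of_nonneg (fun n => by positivity) (hsum.mul_right _),
          tsum_mul_right, ENNReal.ofReal_mul (tsum_nonneg fun n => by positivity)]
        rfl

/-- Bounded fractional-type kernels. -/
def Good (p : ℕ) [Fact p.Prime] (e : ℝ) (h : ℚ_[p] → ℚ_[p] → ℝ) : Prop :=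
  ∃ K : NNReal, ∀ t : ℚ_[p], t ≠ 0 → Measurable (h t) ∧
    ∫⁻ y in {y : ℚ_[p] | ‖y‖ ≤ ‖t‖}, ENNReal.ofReal (h t y) ∂(padicHaar p) ≤
        K * ENNReal.ofReal (‖t‖ ^ e)

lemma Good.add {p : ℕ} [Fact p.Prime] {e : ℝ} {h g : ℚ_[p] → ℚ_[p] → ℝ}
    (hh : Good p e h) (hg : Good p e g) : Good p e (fun t y => h t y + g t y) := by
  obtain ⟨K, hK⟩ := hh
  obtain ⟨L, hL⟩ := hg
  refine ⟨K + L, fun t ht => ⟨(hK t ht).1.add (hL t ht).1, ?_⟩⟩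
  calc _ ≤ ∫⁻ y in {y : ℚ_[p] | ‖y‖ ≤ ‖t‖}, (ENNReal.ofReal (h t y) + ENNReal.ofReal (g t y)) ∂(padicHaar p) :=
        lintegral_mono fun y => ENNReal.ofReal_add_le
    _ = _ := lintegral_add_left (hK t ht).1.ennreal_ofReal _
    _ ≤ _ := add_le_add (hK t ht).2 (hL t ht).2
    _ = _ := by push_cast; ring

lemma Good.smul {p : ℕ} [Fact p.Prime] {e e' : ℝ} (r c : ℝ) {h : ℚ_[p] → ℚ_[p] → ℝ}
    (hh : Good p e h) (hc : 0 ≤ c) (he : e' = r + e) : Good p e' (fun t y => c * ‖t‖ ^ r * h t y) := by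
  obtain ⟨K, hK⟩ := hh
  refine ⟨c.toNNReal * K, fun t ht => ⟨(hK t ht).1.const_mul _, ?_⟩⟩
  have htp : 0 < ‖t‖ := norm_pos_iff.2 ht
  have h0 : 0 ≤ c * ‖t‖ ^ r := by positivity
  simp_rw [ENNReal.ofReal_mul h0]
  rw [lintegral_const_mul _ (hK t ht).1.ennreal_ofReal]
  refine (mul_le_mul_right (hK t ht).2 _).trans (le_of_eq ?_)
  rw [he, Real.rpow_add htp, ENNReal.ofReal_mul hc, ENNReal.ofReal_mul (by positivity)]
  simp only [ENNReal.ofReal, ENNReal.coe_mul]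
  ring

lemma Good.mono {p : ℕ} [Fact p.Prime] {e : ℝ} {h g : ℚ_[p] → ℚ_[p] → ℝ}
    (hh : Good p e h) (hg : ∀ t, Measurable (g t))
    (hle : ∀ t y, t ≠ 0 → ‖y‖ ≤ ‖t‖ → y ≠ t → g t y ≤ h t y) : Good p e g := by
  obtain ⟨K, hK⟩ := hh
  refine ⟨K, fun t ht => ⟨hg t, le_trans ?_ (hK t ht).2⟩⟩
  apply lintegral_mono_ae
  have hm : MeasurableSet {y : ℚ_[p] | ‖y‖ ≤ ‖t‖} := measurableSet_le measurable_norm measurable_const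
  have hne : ∀ᵐ y ∂(padicHaar p), y ≠ t := by
    rw [ae_iff]; simp
  filter_upwards [ae_restrict_mem hm, ae_restrict_of_ae hne] with y hy hy'
  exact ENNReal.ofReal_le_ofReal (hle t y ht hy hy')

lemma good_rpow (p : ℕ) [Fact p.Prime] (s : ℝ) (hs : -1 < s) :
    Good p (s + 1) (fun _ y => ‖y‖ ^ s) := by
  obtain ⟨K, hK⟩ := lint_rpow p s hs
  exact ⟨K, fun t ht => ⟨measurable_norm.pow_const s, hK t ht⟩⟩

lemma good_rpow_sub (p : ℕ) [Fact p.Prime] (s : ℝ) (hs : -1 < s) :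
    Good p (s + 1) (fun t y => ‖t - y‖ ^ s) := by
  obtain ⟨K, hK⟩ := lint_rpow p s hs
  refine ⟨K, fun t ht => ⟨(measurable_const.sub measurable_id).norm.pow_const s, le_trans (le_of_eq ?_) (hK t ht)⟩⟩
  have hm : MeasurableSet {y : ℚ_[p] | ‖y‖ ≤ ‖t‖} := measurableSet_le measurable_norm measurable_const
  rw [← lintegral_indicator hm, ← lintegral_indicator hm,
    ← lintegral_sub_left_eq_self (Set.indicator {y : ℚ_[p] | ‖y‖ ≤ ‖t‖} fun y => ENNReal.ofReal (‖y‖ ^ s)) t]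
  congr 1; ext y
  have aux : ∀ y : ℚ_[p], ‖y‖ ≤ ‖t‖ → ‖t - y‖ ≤ ‖t‖ := by
    intro y hy
    have := IsUltrametricDist.norm_add_le_max t (-y)
    rw [norm_neg, ← sub_eq_add_neg] at this
    exact this.trans (max_le le_rfl hy)
  have iff : ‖t - y‖ ≤ ‖t‖ ↔ ‖y‖ ≤ ‖t‖ := ⟨fun h => by simpa using aux _ h, aux y⟩
  simp [Set.indicator, iff]

lemma norm_t_sub (p : ℕ) [Fact p.Prime] {t y : ℚ_[p]} (h : ‖y‖ < ‖t‖) : ‖t - y‖ = ‖t‖ := by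
  have h2 : ‖t‖ ≠ ‖-y‖ := by rw [norm_neg]; exact h.ne'
  have := IsUltrametricDist.norm_add_eq_max_of_norm_ne_norm h2
  rw [norm_neg, ← sub_eq_add_neg, max_eq_left h.le] at this
  exact this

lemma norm_t_sub_le (p : ℕ) [Fact p.Prime] {t y : ℚ_[p]} (h : ‖y‖ ≤ ‖t‖) : ‖t - y‖ ≤ ‖t‖ := by
  have := IsUltrametricDist.norm_add_le_max t (-y)
  rw [norm_neg, ← sub_eq_add_neg] at this
  exact this.trans (max_le le_rfl h)

lemma abs_log_sub_le {a b ε : ℝ} (ha : 0 < a) (hab : a ≤ b) (hε : 0 < ε) :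
    |Real.log b - Real.log a| ≤ ε⁻¹ * b ^ ε * a ^ (-ε) := by
  have hb : 0 < b := ha.trans_le hab
  rw [abs_of_nonneg (sub_nonneg.2 (Real.log_le_log ha hab)), ← Real.log_div hb.ne' ha.ne']
  refine (Real.log_le_rpow_div (by positivity) hε).trans (le_of_eq ?_)
  rw [Real.div_rpow hb.le ha.le, Real.rpow_neg ha.le]
  field_simp

lemma measurable_Iker (p : ℕ) [Fact p.Prime] (α : ℝ) :
    Measurable (fun z : ℚ_[p] × ℚ_[p] => Iker p α z.1 z.2) := by
  unfold Iker
  split_ifs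
  · exact (Real.measurable_log.comp (measurable_fst.sub measurable_snd).norm).sub
      (Real.measurable_log.comp measurable_snd.norm)
  · exact ((measurable_fst.sub measurable_snd).norm.pow_const _).sub (measurable_snd.norm.pow_const _)

lemma good_Iker (p : ℕ) [Fact p.Prime] (α γ : ℝ)
    (hγ0 : 0 < γ) (hγ : γ < min 1 α) :
    Good p (α - γ) (fun t y => |Iker p α t y| * ‖y‖ ^ (-γ)) := by
  have hγ1 : γ < 1 := hγ.trans_le (min_le_left _ _)
  have hγα : γ < α := hγ.trans_le (min_le_right _ _)
  have hmeas : ∀ t, Measurable (fun y => |Iker p α t y| * ‖y‖ ^ (-γ)) := fun t =>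
    (((measurable_Iker p α).comp (measurable_const.prodMk measurable_id)).norm).mul
      (measurable_norm.pow_const _)
  by_cases hα1 : α = 1
  · subst hα1
    obtain ⟨ε, hε0, hε1⟩ : ∃ ε : ℝ, 0 < ε ∧ ε < 1 - γ := exists_between (by linarith)
    have g1 := (good_rpow p (-γ + -ε) (by linarith)).smul (e' := 1 - γ) ε ε⁻¹ (by positivity) (by ring)
    have g2 := (good_rpow_sub p (-ε) (by linarith)).smul (e' := 1 - γ) (ε + -γ) ε⁻¹ (by positivity) (by ring)
    refine (g1.add g2).mono hmeas ?_
    intro t y ht hy hyt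
    have htp : 0 < ‖t‖ := norm_pos_iff.2 ht
    simp only [Iker, if_true]
    by_cases hy0 : y = 0
    · subst hy0
      rw [norm_zero, Real.zero_rpow (by linarith : -γ ≠ 0), mul_zero]
      positivity
    have hyp : 0 < ‖y‖ := norm_pos_iff.2 hy0
    rcases hy.lt_or_eq with hlt | heq
    · rw [norm_t_sub p hlt, Real.rpow_add hyp]
      have := mul_le_mul_of_nonneg_right (abs_log_sub_le hyp hy hε0) (by positivity : 0 ≤ ‖y‖ ^ (-γ))
      have h2 : 0 ≤ ε⁻¹ * ‖t‖ ^ (ε + -γ) * ‖t‖ ^ (-ε) := by positivity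
      linarith
    · have hty : 0 < ‖t - y‖ := norm_pos_iff.2 (sub_ne_zero.2 (Ne.symm hyt))
      rw [heq, abs_sub_comm, Real.rpow_add htp ε]
      have := mul_le_mul_of_nonneg_right (abs_log_sub_le hty (norm_t_sub_le p hy) hε0) (by positivity : 0 ≤ ‖t‖ ^ (-γ))
      have h2 : 0 ≤ ε⁻¹ * ‖t‖ ^ ε * ‖t‖ ^ (-γ + -ε) := by positivity
      linarith
  · have g1 := (good_rpow p (-γ) (by linarith)).smul (e' := α - γ) (α - 1) 1 zero_le_one (by ring)
    have g2 := (good_rpow p (α - 1 + -γ) (by linarith)).smul (e' := α - γ) 0 1 zero_le_one (by ring)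
    have g3 := (good_rpow_sub p (α - 1) (by linarith)).smul (e' := α - γ) (-γ) 1 zero_le_one (by ring)
    have g4 := (good_rpow p 0 (by linarith)).smul (e' := α - γ) (α - 1 + -γ) 1 zero_le_one (by ring)
    refine ((g1.add g2).add (g3.add g4)).mono hmeas ?_
    intro t y ht hy hyt
    have htp : 0 < ‖t‖ := norm_pos_iff.2 ht
    simp only [Iker, if_neg hα1, Real.rpow_zero, one_mul, mul_one]
    by_cases hy0 : y = 0
    · subst hy0
      rw [norm_zero, Real.zero_rpow (by linarith : -γ ≠ 0), mul_zero]
      positivity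
    have hyp : 0 < ‖y‖ := norm_pos_iff.2 hy0
    rcases hy.lt_or_eq with hlt | heq
    · rw [norm_t_sub p hlt, Real.rpow_add hyp]
      have h1 : |‖t‖ ^ (α - 1) - ‖y‖ ^ (α - 1)| ≤ ‖t‖ ^ (α - 1) + ‖y‖ ^ (α - 1) := by
        refine (abs_sub _ _).trans ?_
        rw [abs_of_nonneg (by positivity), abs_of_nonneg (by positivity)]
      have := mul_le_mul_of_nonneg_right h1 (by positivity : 0 ≤ ‖y‖ ^ (-γ))
      have h2 : 0 ≤ ‖t‖ ^ (-γ) * ‖t‖ ^ (α - 1) + ‖t‖ ^ (α - 1 + -γ) := by positivity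
      linarith
    · rw [heq, Real.rpow_add htp]
      have h1 : |‖t - y‖ ^ (α - 1) - ‖t‖ ^ (α - 1)| ≤ ‖t - y‖ ^ (α - 1) + ‖t‖ ^ (α - 1) := by
        refine (abs_sub _ _).trans ?_
        rw [abs_of_nonneg (by positivity), abs_of_nonneg (by positivity)]
      have := mul_le_mul_of_nonneg_right h1 (by positivity : 0 ≤ ‖t‖ ^ (-γ))
      have h2 : 0 ≤ ‖t‖ ^ (α - 1) * ‖t‖ ^ (-γ) + ‖t‖ ^ (α - 1) * ‖t‖ ^ (-γ) := by positivity
      linarith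

lemma extract_Iker (p : ℕ) [Fact p.Prime] (α γ : ℝ)
    (hγ0 : 0 < γ) (hγ : γ < min 1 α) :
    ∃ K : ℝ, 0 ≤ K ∧ ∀ (t : ℚ_[p]) (D : ℝ) (g : ℚ_[p] → ℝ), t ≠ 0 → Measurable g →
      (∀ y, ‖y‖ ≤ ‖t‖ → |g y| ≤ D * ‖y‖ ^ (-γ)) →
      IntegrableOn (fun y => Iker p α t y * g y) {y : ℚ_[p] | ‖y‖ ≤ ‖t‖} (padicHaar p) ∧
      (0 ≤ D → |∫ y in {y : ℚ_[p] | ‖y‖ ≤ ‖t‖}, Iker p α t y * g y ∂(padicHaar p)| ≤ D * (K * ‖t‖ ^ (α - γ))) := by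
  obtain ⟨K, hK⟩ := good_Iker p α γ hγ0 hγ
  refine ⟨K, NNReal.coe_nonneg K, fun t D g ht hg hb => ?_⟩
  obtain ⟨hm, hl⟩ := hK t ht
  have hS : MeasurableSet {y : ℚ_[p] | ‖y‖ ≤ ‖t‖} := measurableSet_le measurable_norm measurable_const
  have hnn : ∀ y, 0 ≤ |Iker p α t y| * ‖y‖ ^ (-γ) := fun y => by positivity
  have hint : IntegrableOn (fun y => |Iker p α t y| * ‖y‖ ^ (-γ)) {y : ℚ_[p] | ‖y‖ ≤ ‖t‖} (padicHaar p) := by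
    refine ⟨hm.aestronglyMeasurable, ?_⟩
    rw [hasFiniteIntegral_iff_ofReal (Filter.Eventually.of_forall hnn)]
    exact hl.trans_lt (ENNReal.mul_lt_top ENNReal.coe_lt_top ENNReal.ofReal_lt_top)
  have hval : ∫ y in {y : ℚ_[p] | ‖y‖ ≤ ‖t‖}, |Iker p α t y| * ‖y‖ ^ (-γ) ∂(padicHaar p) ≤ K * ‖t‖ ^ (α - γ) := by
    rw [integral_eq_lintegral_of_nonneg_ae (Filter.Eventually.of_forall hnn) hm.aestronglyMeasurable]
    refine ENNReal.toReal_le_of_le_ofReal (by positivity) ?_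
    rw [ENNReal.ofReal_mul (NNReal.coe_nonneg K)]
    simpa using hl
  have hbd : ∀ᵐ y ∂((padicHaar p).restrict {y : ℚ_[p] | ‖y‖ ≤ ‖t‖}),
      ‖Iker p α t y * g y‖ ≤ D * (|Iker p α t y| * ‖y‖ ^ (-γ)) := by
    filter_upwards [ae_restrict_mem hS] with y hy
    rw [Real.norm_eq_abs, abs_mul]
    have := mul_le_mul_of_nonneg_left (hb y hy) (abs_nonneg (Iker p α t y))
    linarith
  have hmI : Measurable (fun y => Iker p α t y * g y) :=
    ((measurable_Iker p α).comp (measurable_const.prodMk measurable_id)).mul hg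
  refine ⟨Integrable.mono' (hint.const_mul D) hmI.aestronglyMeasurable hbd, fun hD => ?_⟩
  have := norm_integral_le_of_norm_le (hint.const_mul D) hbd
  rw [integral_const_mul] at this
  exact this.trans (mul_le_mul_of_nonneg_left hval hD)

lemma measurable_val (p : ℕ) [Fact p.Prime] : Measurable (fun y : ℚ_[p] => -y.valuation) := by
  have hp1 : (1:ℝ) < p := by exact_mod_cast (Fact.out : p.Prime).one_lt
  have : (fun y : ℚ_[p] => -y.valuation) = fun y => ⌊Real.log ‖y‖ / Real.log p⌋ := by
    ext y
    by_cases hy : y = 0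
    · subst hy; simp
    · have hl : Real.log p ≠ 0 := (Real.log_pos hp1).ne'
      rw [Padic.norm_eq_zpow_neg_valuation hy, Real.log_zpow, mul_div_cancel_right₀ _ hl, Int.floor_intCast]
  rw [this]
  exact Int.measurable_floor.comp ((Real.measurable_log.comp measurable_norm).div_const _)

lemma measurable_Iop (p : ℕ) [Fact p.Prime] (α : ℝ) {g : ℚ_[p] → ℝ} (hg : Measurable g) :
    Measurable (Iop p α g) := by
  unfold Iop
  refine Measurable.const_mul ?_ _
  have hS : ∀ t : ℚ_[p], MeasurableSet {y : ℚ_[p] | ‖y‖ ≤ ‖t‖} := fun t =>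
    measurableSet_le measurable_norm measurable_const
  have : (fun t : ℚ_[p] => ∫ y in {y : ℚ_[p] | ‖y‖ ≤ ‖t‖}, Iker p α t y * g y ∂(padicHaar p)) =
      fun t => ∫ y, Set.indicator {z : ℚ_[p] × ℚ_[p] | ‖z.2‖ ≤ ‖z.1‖} (fun z => Iker p α z.1 z.2 * g z.2) (t, y) ∂(padicHaar p) := by
    ext t
    rw [← integral_indicator (hS t)]
    rfl
  rw [this]
  refine StronglyMeasurable.measurable (StronglyMeasurable.integral_prod_right
    (f := fun t y => Set.indicator {z : ℚ_[p] × ℚ_[p] | ‖z.2‖ ≤ ‖z.1‖} (fun z => Iker p α z.1 z.2 * g z.2) (t, y)) ?_)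
  refine Measurable.stronglyMeasurable ?_
  exact ((measurable_Iker p α).mul (hg.comp measurable_snd)).indicator
    (measurableSet_le measurable_snd.norm measurable_fst.norm)

/-- estimates for the successive approximations. -/
theorem successive_approximations_estimate (p : ℕ) [Fact p.Prime] (α γ : ℝ)
    (hα : 0 < α) (hγ0 : 0 < γ) (hγ : γ < min 1 α) :
    ∃ C : ℝ, 0 < C ∧ ∀ (f : ℤ → ℝ → ℝ) (M F : ℝ),
      (∀ (ℓ : ℤ) (x : ℝ), |f ℓ x| ≤ M) →
      (∀ (ℓ : ℤ) (x y : ℝ), |f ℓ x - f ℓ y| ≤ F * |x - y|) →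
      ∀ (u₀ : ℝ) (U : ℕ → ℚ_[p] → ℝ),
        (∀ t : ℚ_[p], U 0 t = u₀) →
        (∀ (k : ℕ) (t : ℚ_[p]),
          U (k + 1) t = u₀ + Iop p α (fun s => ‖s‖ ^ (-γ) * f (-s.valuation) (U k s)) t) →
        ∀ (k : ℕ) (t : ℚ_[p]), t ≠ 0 →
          IntegrableOn (fun y => Iker p α t y * (‖y‖ ^ (-γ) * f (-y.valuation) (U k y)))
            {y : ℚ_[p] | ‖y‖ ≤ ‖t‖} (padicHaar p) ∧
          |U (k + 1) t - U k t| ≤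
            C ^ (k + 1) * M * F ^ k * ‖t‖ ^ (((k : ℝ) + 1) * (α - γ)) := by
  obtain ⟨K, hK0, hK⟩ := extract_Iker p α γ hγ0 hγ
  refine ⟨|Icoef p α| * K + 1, by positivity, ?_⟩
  intro f M F hM hF u₀ U hU0 hU
  set C : ℝ := |Icoef p α| * K + 1 with hC
  have hC0 : 0 < C := by positivity
  have hKC : |Icoef p α| * K ≤ C := by linarith
  have hM0 : 0 ≤ M := (abs_nonneg _).trans (hM 0 0)
  have hF0 : 0 ≤ F := by simpa using (abs_nonneg _).trans (hF 0 1 0)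
  have hγα : γ < α := hγ.trans_le (min_le_right _ _)
  -- measurability of the nonlinear term
  have hfm : Measurable (fun q : ℤ × ℝ => f q.1 q.2) := by
    apply measurable_from_prod_countable_right
    intro l
    have : LipschitzWith F.toNNReal (f l) := LipschitzWith.of_dist_le_mul fun x y => by
      rw [Real.dist_eq, Real.dist_eq, Real.coe_toNNReal _ hF0]; exact hF l x y
    exact this.continuous.measurable
  have hgm : ∀ V : ℚ_[p] → ℝ, Measurable V →
      Measurable (fun s : ℚ_[p] => ‖s‖ ^ (-γ) * f (-s.valuation) (V s)) := fun V hV =>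
    (measurable_norm.pow_const _).mul (hfm.comp ((measurable_val p).prodMk hV))
  have hUm : ∀ k, Measurable (U k) := by
    intro k
    induction k with
    | zero => rw [show U 0 = fun _ => u₀ from funext hU0]; exact measurable_const
    | succ k ih =>
      rw [show U (k + 1) = fun t => u₀ + Iop p α (fun s => ‖s‖ ^ (-γ) * f (-s.valuation) (U k s)) t
        from funext (hU k)]
      exact (measurable_Iop p α (hgm _ ih)).const_add _
  have hgb : ∀ k (y : ℚ_[p]), |‖y‖ ^ (-γ) * f (-y.valuation) (U k y)| ≤ M * ‖y‖ ^ (-γ) := by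
    intro k y
    rw [abs_mul, abs_of_nonneg (by positivity : 0 ≤ ‖y‖ ^ (-γ)), mul_comm]
    gcongr
    exact hM _ _
  have hI : ∀ (k : ℕ) (t : ℚ_[p]), t ≠ 0 →
      IntegrableOn (fun y => Iker p α t y * (‖y‖ ^ (-γ) * f (-y.valuation) (U k y)))
            {y : ℚ_[p] | ‖y‖ ≤ ‖t‖} (padicHaar p) := fun k t ht =>
    (hK t M _ ht (hgm _ (hUm k)) (fun y _ => hgb k y)).1
  have hest : ∀ (k : ℕ) (t : ℚ_[p]), t ≠ 0 → |U (k + 1) t - U k t| ≤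
            C ^ (k + 1) * M * F ^ k * ‖t‖ ^ (((k : ℝ) + 1) * (α - γ)) := by
    intro k
    induction k with
    | zero =>
      intro t ht
      have h1 := (hK t M _ ht (hgm _ (hUm 0)) (fun y _ => hgb 0 y)).2 hM0
      rw [hU 0 t, hU0 t, add_sub_cancel_left, Iop, abs_mul]
      calc _ ≤ |Icoef p α| * (M * (K * ‖t‖ ^ (α - γ))) := by gcongr
        _ = (|Icoef p α| * K) * (M * ‖t‖ ^ (α - γ)) := by ring
        _ ≤ C * (M * ‖t‖ ^ (α - γ)) := by gcongr
        _ = _ := by simp; ring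
    | succ k ih =>
      intro t ht
      have htp : 0 < ‖t‖ := norm_pos_iff.2 ht
      set D : ℝ := F * (C ^ (k + 1) * M * F ^ k * ‖t‖ ^ (((k : ℝ) + 1) * (α - γ))) with hD
      have hD0 : 0 ≤ D := by positivity
      have hdm := (hgm _ (hUm (k + 1))).sub (hgm _ (hUm k))
      have h1 := (hK t D _ ht hdm (fun y hy => by
        simp only [Pi.sub_apply]
        by_cases hy0 : y = 0
        · subst hy0
          rw [norm_zero, Real.zero_rpow (by linarith : -γ ≠ 0)]
          simp
        rw [← mul_sub, abs_mul, abs_of_nonneg (by positivity : 0 ≤ ‖y‖ ^ (-γ)), mul_comm]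
        refine mul_le_mul_of_nonneg_right ?_ (by positivity)
        refine (hF _ _ _).trans ?_
        rw [hD]
        refine mul_le_mul_of_nonneg_left ((ih y hy0).trans ?_) hF0
        have he : 0 ≤ ((k : ℝ) + 1) * (α - γ) := mul_nonneg (by positivity) (by linarith)
        gcongr)).2 hD0
      simp only [Pi.sub_apply, mul_sub] at h1
      rw [integral_sub (hI (k + 1) t ht) (hI k t ht)] at h1
      rw [hU (k + 1) t, hU k t, add_sub_add_left_eq_sub, Iop, Iop, ← mul_sub, abs_mul]
      calc _ ≤ |Icoef p α| * (D * (K * ‖t‖ ^ (α - γ))) := by gcongr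
        _ = (|Icoef p α| * K) * (D * ‖t‖ ^ (α - γ)) := by ring
        _ ≤ C * (D * ‖t‖ ^ (α - γ)) := by gcongr
        _ = _ := by
          have : (((k + 1 : ℕ) : ℝ) + 1) * (α - γ) = ((k : ℝ) + 1) * (α - γ) + (α - γ) := by
            push_cast; ring
          rw [this, Real.rpow_add htp, hD]
          ring
  exact fun k t ht => ⟨hI k t ht, hest k t ht⟩
end

section
/- Let α > 0, let γ satisfy 0 < γ < min(1, α), let u_0 ∈ ℝ, and let f : {p^k : k ∈ ℤ} × ℝ → ℝ satisfy |f(r, x)| ≤ M and |f(r, x) − f(r, y)| ≤ F |x − y| for all r and all x, y ∈ ℝ. If u and ū are two radial functions on the ball {t : |t|_p ≤ p^N} with u(0) = ū(0) = u_0 that both satisfy u(|t|_p) = u_0 + (I^α [ f̃(|·|_p, u(|·|_p)) ])(|t|_p) (respectively for ū) for all nonzero t with |t|_p ≤ p^N, then there exists K ∈ ℤ with K ≤ N such that u(|t|_p) = ū(|t|_p) for all t with |t|_p ≤ p^K; in particular the local mild solution is unique on a sufficiently small ball. -/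
open MeasureTheory Metric

section helpers

variable (p : ℕ) [hp : Fact p.Prime]

instance padicHaar_isAddHaar : (padicHaar p).IsAddHaarMeasure := by
  unfold padicHaar; infer_instance

theorem padicHaar_unit : padicHaar p (closedBall 0 1) = 1 :=
  Measure.addHaarMeasure_self (K₀ := unitBallPC p)

theorem ball_step (k : ℤ) :
    (p : ENNReal) * padicHaar p (closedBall 0 ((p : ℝ) ^ k))
      ≤ padicHaar p (closedBall 0 ((p : ℝ) ^ (k + 1))) := by
  have hp1 : (1 : ℝ) < p := by exact_mod_cast hp.1.one_lt
  have hp0 : (0 : ℝ) < p := by linarith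
  have hpk : (0 : ℝ) < (p : ℝ) ^ (k + 1) := zpow_pos hp0 _
  let c : Fin p → ℚ_[p] := fun i => ((i : ℕ) : ℚ_[p]) * (p : ℚ_[p]) ^ (-(k + 1))
  have hpn : ‖(p : ℚ_[p]) ^ (-(k + 1))‖ = (p : ℝ) ^ (k + 1) := by
    rw [Padic.norm_p_zpow]; simp
  have hdisj : Pairwise (Function.onFun Disjoint fun i : Fin p => closedBall (c i) ((p : ℝ) ^ k)) := by
    intro i j hij
    have hd : dist (c i) (c j) = (p : ℝ) ^ (k + 1) := by
      have e : c i - c j = (((i : ℕ) : ℤ) - ((j : ℕ) : ℤ) : ℤ) * (p : ℚ_[p]) ^ (-(k + 1)) := by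
        simp only [c]; push_cast; ring
      rw [dist_eq_norm, e, norm_mul, hpn]
      have : ‖((((i : ℕ) : ℤ) - ((j : ℕ) : ℤ) : ℤ) : ℚ_[p])‖ = 1 := by
        refine le_antisymm (Padic.norm_int_le_one _) ?_
        by_contra hlt
        rw [not_le, Padic.norm_intCast_lt_one_iff] at hlt
        have h1 := Int.eq_zero_of_abs_lt_dvd hlt (by
          have := i.2; have := j.2
          rw [abs_lt]; constructor <;> omega)
        apply hij; ext; omega
      rw [this, one_mul]
    rw [Function.onFun, Set.disjoint_left]
    intro x hx hy
    rw [mem_closedBall] at hx hy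
    have h1 : dist (c i) (c j) ≤ max (dist (c i) x) (dist x (c j)) := dist_triangle_max _ _ _
    rw [dist_comm (c i) x, hd] at h1
    have h2 : (p : ℝ) ^ (k + 1) ≤ (p : ℝ) ^ k := h1.trans (max_le hx hy)
    have h3 : (p : ℝ) ^ k < (p : ℝ) ^ (k + 1) := zpow_lt_zpow_right₀ hp1 (by omega)
    linarith
  have hsub : (⋃ i : Fin p, closedBall (c i) ((p : ℝ) ^ k)) ⊆ closedBall 0 ((p : ℝ) ^ (k + 1)) := by
    intro x hx
    obtain ⟨i, hi⟩ := Set.mem_iUnion.1 hx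
    rw [mem_closedBall] at hi ⊢
    have h1 : dist x 0 ≤ max (dist x (c i)) (dist (c i) 0) := dist_triangle_max _ _ _
    refine h1.trans (max_le (hi.trans ?_) ?_)
    · exact zpow_le_zpow_right₀ hp1.le (by omega)
    · rw [dist_zero_right]
      simp only [c]
      rw [norm_mul, hpn]
      have : ‖(((i : ℕ) : ℤ) : ℚ_[p])‖ ≤ 1 := Padic.norm_int_le_one _
      simp only [Int.cast_natCast] at this
      nlinarith
  have hm := measure_iUnion (μ := padicHaar p) hdisj (fun i => isClosed_closedBall.measurableSet)
  have he : ∀ i : Fin p, padicHaar p (closedBall (c i) ((p : ℝ) ^ k))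
      = padicHaar p (closedBall 0 ((p : ℝ) ^ k)) := fun i =>
    Measure.addHaar_closedBall_center _ _ _
  have := measure_mono (μ := padicHaar p) hsub
  rw [hm] at this
  simpa [he] using this

theorem ball_le (n : ℕ) :
    padicHaar p (closedBall 0 ((p : ℝ) ^ (-(n : ℤ)))) ≤ ENNReal.ofReal ((p : ℝ) ^ (-(n : ℤ))) := by
  have hp1 : (1 : ℝ) < p := by exact_mod_cast hp.1.one_lt
  have hp0 : (0 : ℝ) < p := by linarith
  induction n with
  | zero => simp [padicHaar_unit]
  | succ n ih =>
    have h := ball_step p (-((n + 1 : ℕ) : ℤ))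
    have e : -((n + 1 : ℕ) : ℤ) + 1 = -(n : ℤ) := by push_cast; ring
    rw [e] at h
    have h2 := h.trans ih
    have e2 : (p : ℝ) ^ (-(n : ℤ)) = p * (p : ℝ) ^ (-((n + 1 : ℕ) : ℤ)) := by
      rw [← e, zpow_add₀ hp0.ne', zpow_one, mul_comm]
    rw [e2, ENNReal.ofReal_mul hp0.le, ENNReal.ofReal_natCast] at h2
    exact (ENNReal.mul_le_mul_iff_right (by exact_mod_cast hp.1.ne_zero)
      (ENNReal.natCast_ne_top p)).1 h2

theorem norm_exists (t : ℚ_[p]) (ht : t ≠ 0) (h1 : ‖t‖ ≤ 1) :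
    ∃ n : ℕ, ‖t‖ = (p : ℝ) ^ (-(n : ℤ)) := by
  have hp1 : (1 : ℝ) < p := by exact_mod_cast hp.1.one_lt
  have h := Padic.norm_eq_zpow_neg_valuation ht
  have : 0 ≤ t.valuation := by
    by_contra hlt
    push Not at hlt
    rw [h] at h1
    have := one_lt_zpow₀ hp1 (n := -t.valuation) (by omega)
    linarith
  obtain ⟨n, hn⟩ := Int.eq_ofNat_of_zero_le this
  exact ⟨n, by rw [h, hn]⟩

theorem singleton_null (x : ℚ_[p]) : padicHaar p {x} = 0 := by
  have hp1 : (1 : ℝ) < p := by exact_mod_cast hp.1.one_lt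
  have hp0 : (0 : ℝ) < p := by linarith
  have h : ∀ n : ℕ, padicHaar p {x} ≤ ENNReal.ofReal (((p : ℝ)⁻¹) ^ n) := by
    intro n
    have := ball_le p n
    rw [← Measure.addHaar_closedBall_center (padicHaar p) x] at this
    have e : (p : ℝ) ^ (-(n : ℤ)) = ((p : ℝ)⁻¹) ^ n := by simp
    rw [e] at this
    refine (measure_mono ?_).trans this
    rw [Set.singleton_subset_iff]
    exact mem_closedBall_self (by positivity)
  have ht : Filter.Tendsto (fun n : ℕ => ENNReal.ofReal (((p : ℝ)⁻¹) ^ n)) Filter.atTop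
      (nhds (ENNReal.ofReal 0)) :=
    ENNReal.tendsto_ofReal (tendsto_pow_atTop_nhds_zero_of_lt_one (by positivity)
      (inv_lt_one_of_one_lt₀ hp1))
  rw [ENNReal.ofReal_zero] at ht
  exact le_antisymm (ge_of_tendsto' ht h) bot_le

theorem ae_ne (x : ℚ_[p]) : ∀ᵐ y ∂(padicHaar p), y ≠ x := by
  rw [ae_iff]; simpa using singleton_null p x

theorem meas_pow (s : ℝ) : Measurable (fun y : ℚ_[p] => ‖y‖ ^ s) :=
  continuous_norm.measurable.pow_const s

theorem meas_ball (r : ℝ) : MeasurableSet {y : ℚ_[p] | ‖y‖ ≤ r} :=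
  (isClosed_le continuous_norm continuous_const).measurableSet

theorem pow_integral (s : ℝ) (hs : -1 < s) : ∃ C : ℝ, 0 ≤ C ∧ ∀ t : ℚ_[p], t ≠ 0 → ‖t‖ ≤ 1 →
    IntegrableOn (fun y => ‖y‖ ^ s) {y : ℚ_[p] | ‖y‖ ≤ ‖t‖} (padicHaar p) ∧
    ∫ y in {y : ℚ_[p] | ‖y‖ ≤ ‖t‖}, ‖y‖ ^ s ∂(padicHaar p) ≤ C * ‖t‖ ^ (s + 1) := by
  have hp1 : (1 : ℝ) < p := by exact_mod_cast hp.1.one_lt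
  have hp0 : (0 : ℝ) < p := by linarith
  set q : ℝ := (p : ℝ) ^ (-(s + 1)) with hq
  have hq0 : 0 < q := Real.rpow_pos_of_pos hp0 _
  have hq1 : q < 1 := Real.rpow_lt_one_of_one_lt_of_neg hp1 (by linarith)
  have hsum := summable_geometric_of_lt_one hq0.le hq1
  refine ⟨∑' m : ℕ, q ^ m, tsum_nonneg fun m => by positivity, ?_⟩
  intro t ht ht1
  obtain ⟨n, hn⟩ := norm_exists p t ht ht1
  have hT : 0 < ‖t‖ := norm_pos_iff.2 ht
  let R : ℕ → ℝ := fun m => (p : ℝ) ^ (-((n + m : ℕ) : ℤ))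
  have hR0 : ∀ m, 0 < R m := fun m => zpow_pos hp0 _
  have hR : ∀ m, R m * R m ^ s = ‖t‖ ^ (s + 1) * q ^ m := by
    intro m
    have e1 : R m * R m ^ s = R m ^ (s + 1) := by
      rw [Real.rpow_add_one (hR0 m).ne', mul_comm]
    rw [e1, hn, hq, ← Real.rpow_natCast]
    simp only [R]
    rw [← Real.rpow_intCast, ← Real.rpow_intCast, ← Real.rpow_mul hp0.le, ← Real.rpow_mul hp0.le,
      ← Real.rpow_mul hp0.le, ← Real.rpow_add hp0]
    congr 1; push_cast; ring
  have key : ∫⁻ y in {y : ℚ_[p] | ‖y‖ ≤ ‖t‖}, ENNReal.ofReal (‖y‖ ^ s) ∂(padicHaar p)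
      ≤ ENNReal.ofReal ((∑' m : ℕ, q ^ m) * ‖t‖ ^ (s + 1)) := by
    calc ∫⁻ y in {y : ℚ_[p] | ‖y‖ ≤ ‖t‖}, ENNReal.ofReal (‖y‖ ^ s) ∂(padicHaar p)
        ≤ ∫⁻ y, ∑' m : ℕ, (closedBall (0 : ℚ_[p]) (R m)).indicator
            (fun _ => ENNReal.ofReal (R m ^ s)) y ∂(padicHaar p) := by
          rw [← lintegral_indicator (meas_ball p _)]
          refine lintegral_mono_ae ?_
          filter_upwards [ae_ne p 0] with y hy
          by_cases hyt : ‖y‖ ≤ ‖t‖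
          · rw [Set.indicator_of_mem (by exact hyt)]
            obtain ⟨k, hk⟩ := norm_exists p y hy (hyt.trans ht1)
            have hnk : n ≤ k := by
              rw [hn, hk, zpow_le_zpow_iff_right₀ hp1] at hyt
              omega
            have hkm : ‖y‖ = R (k - n) := by
              simp only [R]; rw [hk, Nat.add_sub_cancel' hnk]
            refine le_trans ?_ (ENNReal.le_tsum (k - n))
            rw [Set.indicator_of_mem (by simp [hkm]), hkm]
          · rw [Set.indicator_of_notMem (by exact hyt)]; exact bot_le
      _ = ∑' m : ℕ, ENNReal.ofReal (R m ^ s) * padicHaar p (closedBall (0 : ℚ_[p]) (R m)) := by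
          rw [lintegral_tsum]
          · congr 1; ext m
            rw [lintegral_indicator_const isClosed_closedBall.measurableSet]
          · intro m
            exact (measurable_const.indicator isClosed_closedBall.measurableSet).aemeasurable
      _ ≤ ∑' m : ℕ, ENNReal.ofReal (‖t‖ ^ (s + 1) * q ^ m) := by
          refine ENNReal.tsum_le_tsum fun m => ?_
          rw [← hR, mul_comm, ENNReal.ofReal_mul (hR0 m).le]
          gcongr
          exact ball_le p (n + m)
      _ = _ := by
          rw [mul_comm, ← tsum_mul_left, ENNReal.ofReal_tsum_of_nonneg]
          · intro m; positivity
          · exact hsum.mul_left _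
  have hnn : 0 ≤ᵐ[(padicHaar p).restrict {y : ℚ_[p] | ‖y‖ ≤ ‖t‖}] fun y => ‖y‖ ^ s :=
    Filter.Eventually.of_forall fun y => by positivity
  refine ⟨⟨(meas_pow p s).aestronglyMeasurable, ?_⟩, ?_⟩
  · rw [hasFiniteIntegral_iff_ofReal hnn]
    exact key.trans_lt ENNReal.ofReal_lt_top
  · rw [integral_eq_lintegral_of_nonneg_ae hnn (meas_pow p s).aestronglyMeasurable]
    refine ENNReal.toReal_le_of_le_ofReal ?_ key
    exact mul_nonneg (tsum_nonneg fun m => by positivity) (by positivity)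

theorem norm_sub_max (t y : ℚ_[p]) : ‖t - y‖ ≤ max ‖t‖ ‖y‖ := by
  rw [sub_eq_add_neg, ← norm_neg y]
  exact Padic.nonarchimedean _ _

theorem shift_integral (s : ℝ) (hs : -1 < s) : ∃ C : ℝ, 0 ≤ C ∧ ∀ t : ℚ_[p], t ≠ 0 → ‖t‖ ≤ 1 →
    IntegrableOn (fun y => ‖t - y‖ ^ s) {y : ℚ_[p] | ‖y‖ ≤ ‖t‖} (padicHaar p) ∧
    ∫ y in {y : ℚ_[p] | ‖y‖ ≤ ‖t‖}, ‖t - y‖ ^ s ∂(padicHaar p) ≤ C * ‖t‖ ^ (s + 1) := by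
  obtain ⟨C, hC, h⟩ := pow_integral p s hs
  refine ⟨C, hC, fun t ht ht1 => ?_⟩
  obtain ⟨h1, h2⟩ := h t ht ht1
  have hiff : ∀ y : ℚ_[p], ‖t - y‖ ≤ ‖t‖ ↔ ‖y‖ ≤ ‖t‖ := by
    intro y
    constructor
    · intro hy
      have := norm_sub_max p t (t - y)
      rw [sub_sub_cancel] at this
      exact this.trans (max_le le_rfl hy)
    · intro hy
      exact (norm_sub_max p t y).trans (max_le le_rfl hy)
  have he : {y : ℚ_[p] | ‖y‖ ≤ ‖t‖}.indicator (fun y => ‖t - y‖ ^ s)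
      = fun y => ({y : ℚ_[p] | ‖y‖ ≤ ‖t‖}.indicator (fun y => ‖y‖ ^ s)) (t - y) := by
    ext y
    by_cases hy : ‖y‖ ≤ ‖t‖
    · rw [Set.indicator_of_mem (by exact hy), Set.indicator_of_mem (by exact (hiff y).2 hy)]
    · rw [Set.indicator_of_notMem (by exact hy),
        Set.indicator_of_notMem (by exact fun h => hy ((hiff y).1 h))]
  rw [← integrable_indicator_iff (meas_ball p _)] at h1 ⊢
  rw [← integral_indicator (meas_ball p _)] at h2 ⊢
  rw [he]
  refine ⟨h1.comp_sub_left t, ?_⟩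
  rw [integral_sub_left_eq_self (fun y => {y : ℚ_[p] | ‖y‖ ≤ ‖t‖}.indicator (fun y => ‖y‖ ^ s) y)
    (padicHaar p) t]
  exact h2

theorem norm_sub_of_lt (t y : ℚ_[p]) (h : ‖y‖ < ‖t‖) : ‖t - y‖ = ‖t‖ := by
  rw [sub_eq_add_neg, Padic.add_eq_max_of_ne (by rw [norm_neg]; exact h.ne'), norm_neg,
    max_eq_left h.le]

theorem log_sub_le (x r ε : ℝ) (hx : 0 < x) (hxr : x ≤ r) (hε : 0 < ε) :
    |Real.log r - Real.log x| ≤ ε⁻¹ * r ^ ε * x ^ (-ε) := by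
  have hr : 0 < r := hx.trans_le hxr
  rw [abs_of_nonneg (sub_nonneg.2 (Real.log_le_log hx hxr)), ← Real.log_div hr.ne' hx.ne']
  refine (Real.log_le_rpow_div (by positivity) hε).trans_eq ?_
  rw [Real.div_rpow hr.le hx.le, Real.rpow_neg hx.le]
  field_simp

theorem kernel_bound (α γ : ℝ) (hα : 0 < α) (hγ0 : 0 < γ) (hγ : γ < min 1 α) :
    ∃ A a b c d e g : ℝ, 0 ≤ A ∧ -1 < b ∧ -1 < d ∧ -1 < g ∧ a + (b + 1) = α - γ ∧
      c + (d + 1) = α - γ ∧ e + (g + 1) = α - γ ∧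
      ∀ t y : ℚ_[p], t ≠ 0 → y ≠ 0 → y ≠ t → ‖y‖ ≤ ‖t‖ →
        |Iker p α t y| * ‖y‖ ^ (-γ) ≤
          A * ‖t‖ ^ a * ‖y‖ ^ b + A * ‖t‖ ^ c * ‖y‖ ^ d + A * ‖t‖ ^ e * ‖t - y‖ ^ g := by
  have hγ1 : γ < 1 := hγ.trans_le (min_le_left _ _)
  have hγα : γ < α := hγ.trans_le (min_le_right _ _)
  by_cases h1 : α = 1
  · subst h1
    set ε : ℝ := (1 - γ) / 2 with hε
    have hε0 : 0 < ε := by rw [hε]; linarith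
    refine ⟨ε⁻¹, ε, -ε - γ, ε, -ε - γ, ε - γ, -ε, by positivity, by linarith, by linarith,
      by linarith, by ring, by ring, by ring, ?_⟩
    intro t y ht hy hyt hle
    have hT : 0 < ‖t‖ := norm_pos_iff.2 ht
    have hY : 0 < ‖y‖ := norm_pos_iff.2 hy
    have hTY : 0 < ‖t - y‖ := norm_pos_iff.2 (sub_ne_zero.2 hyt.symm)
    simp only [Iker, if_true]
    have p1 : 0 ≤ ε⁻¹ * ‖t‖ ^ ε * ‖y‖ ^ (-ε - γ) := by positivity
    have p2 : 0 ≤ ε⁻¹ * ‖t‖ ^ (ε - γ) * ‖t - y‖ ^ (-ε) := by positivity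
    rcases hle.lt_or_eq with hlt | heq
    · rw [norm_sub_of_lt p t y hlt] at p2 ⊢
      have := mul_le_mul_of_nonneg_right (log_sub_le ‖y‖ ‖t‖ ε hY hle hε0)
        (by positivity : 0 ≤ ‖y‖ ^ (-γ))
      have e : ε⁻¹ * ‖t‖ ^ ε * ‖y‖ ^ (-ε) * ‖y‖ ^ (-γ) = ε⁻¹ * ‖t‖ ^ ε * ‖y‖ ^ (-ε - γ) := by
        rw [mul_assoc, ← Real.rpow_add hY]; rfl
      linarith
    · have hle2 : ‖t - y‖ ≤ ‖t‖ :=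
        (norm_sub_max p t y).trans (max_le le_rfl hle)
      have := mul_le_mul_of_nonneg_right (log_sub_le ‖t - y‖ ‖t‖ ε hTY hle2 hε0)
        (by positivity : 0 ≤ ‖y‖ ^ (-γ))
      have e : ε⁻¹ * ‖t‖ ^ ε * ‖t - y‖ ^ (-ε) * ‖y‖ ^ (-γ)
          = ε⁻¹ * ‖t‖ ^ (ε - γ) * ‖t - y‖ ^ (-ε) := by
        rw [heq, sub_eq_add_neg ε γ, Real.rpow_add hT]; ring
      rw [abs_sub_comm, ← heq] at this
      rw [← heq] at e p1 p2 ⊢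
      linarith
  · refine ⟨1, α - 1, -γ, 0, α - 1 - γ, -γ, α - 1, by positivity, by linarith, by linarith,
      by linarith, by ring, by ring, by ring, ?_⟩
    intro t y ht hy hyt hle
    have hT : 0 < ‖t‖ := norm_pos_iff.2 ht
    have hY : 0 < ‖y‖ := norm_pos_iff.2 hy
    simp only [Iker, if_neg h1, one_mul, Real.rpow_zero]
    have h0 : |‖t - y‖ ^ (α - 1) - ‖y‖ ^ (α - 1)| ≤ ‖t - y‖ ^ (α - 1) + ‖y‖ ^ (α - 1) := by
      have q1 : 0 ≤ ‖t - y‖ ^ (α - 1) := by positivity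
      have q2 : 0 ≤ ‖y‖ ^ (α - 1) := by positivity
      rw [abs_le]; constructor <;> linarith
    have h2 := mul_le_mul_of_nonneg_right h0 (by positivity : 0 ≤ ‖y‖ ^ (-γ))
    have e : ‖y‖ ^ (α - 1) * ‖y‖ ^ (-γ) = ‖y‖ ^ (α - 1 - γ) := by
      rw [← Real.rpow_add hY]; rfl
    rw [add_mul, e] at h2
    have p1 : 0 ≤ ‖t‖ ^ (α - 1) * ‖y‖ ^ (-γ) := by positivity
    have p2 : 0 ≤ ‖t‖ ^ (-γ) * ‖t - y‖ ^ (α - 1) := by positivity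
    rcases hle.lt_or_eq with hlt | heq
    · have e2 := norm_sub_of_lt p t y hlt
      rw [e2] at h2 p2 ⊢
      linarith
    · rw [heq] at h2 p1 ⊢
      linarith

theorem main_bound (α γ : ℝ) (hα : 0 < α) (hγ0 : 0 < γ) (hγ : γ < min 1 α) :
    ∃ C : ℝ, 0 ≤ C ∧ ∀ t : ℚ_[p], t ≠ 0 → ‖t‖ ≤ 1 → ∀ (D : ℝ) (h : ℚ_[p] → ℝ),
      (∀ y, ‖y‖ ≤ ‖t‖ → |h y| ≤ D) →
      |∫ y in {y : ℚ_[p] | ‖y‖ ≤ ‖t‖}, Iker p α t y * (‖y‖ ^ (-γ) * h y) ∂(padicHaar p)|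
        ≤ D * (C * ‖t‖ ^ (α - γ)) := by
  obtain ⟨A, a, b, c, d, e, g, hA, hb, hd, hg, ha, hc, he, hk⟩ := kernel_bound p α γ hα hγ0 hγ
  obtain ⟨C1, hC1, H1⟩ := pow_integral p b hb
  obtain ⟨C2, hC2, H2⟩ := pow_integral p d hd
  obtain ⟨C3, hC3, H3⟩ := shift_integral p g hg
  refine ⟨A * (C1 + C2 + C3), by positivity, ?_⟩
  intro t ht ht1 D h hh
  have hT : 0 < ‖t‖ := norm_pos_iff.2 ht
  have hD : 0 ≤ D := (abs_nonneg _).trans (hh t le_rfl)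
  obtain ⟨i1, j1⟩ := H1 t ht ht1
  obtain ⟨i2, j2⟩ := H2 t ht ht1
  obtain ⟨i3, j3⟩ := H3 t ht ht1
  have k1 := i1.const_mul (A * ‖t‖ ^ a)
  have k2 := i2.const_mul (A * ‖t‖ ^ c)
  have k3 := i3.const_mul (A * ‖t‖ ^ e)
  have kk := ((k1.add k2).add k3).const_mul D
  have hle := norm_integral_le_of_norm_le (μ := (padicHaar p).restrict {y : ℚ_[p] | ‖y‖ ≤ ‖t‖})
    (f := fun y => Iker p α t y * (‖y‖ ^ (-γ) * h y)) kk (by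
      rw [ae_restrict_iff' (meas_ball p _)]
      filter_upwards [ae_ne p 0, ae_ne p t] with y hy hyt hle
      have q := hk t y ht hy hyt hle
      have q2 := hh y hle
      have q3 : 0 ≤ |Iker p α t y| * ‖y‖ ^ (-γ) := by positivity
      rw [Real.norm_eq_abs, abs_mul, abs_mul, abs_of_nonneg (by positivity : 0 ≤ ‖y‖ ^ (-γ))]
      simp only [Pi.add_apply]
      calc _ = |h y| * (|Iker p α t y| * ‖y‖ ^ (-γ)) := by ring
        _ ≤ D * _ := mul_le_mul q2 q q3 hD)
  rw [Real.norm_eq_abs] at hle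
  refine hle.trans ?_
  rw [integral_const_mul]
  refine mul_le_mul_of_nonneg_left ?_ hD
  have e1 := integral_add (k1.add k2) k3
  have e2 := integral_add k1 k2
  simp only [Pi.add_apply] at e1 e2 ⊢
  rw [e1, e2, integral_const_mul, integral_const_mul, integral_const_mul]
  have m1 : A * ‖t‖ ^ a * (C1 * ‖t‖ ^ (b + 1)) = A * C1 * ‖t‖ ^ (α - γ) := by
    rw [← ha, Real.rpow_add hT a (b + 1)]; ring
  have m2 : A * ‖t‖ ^ c * (C2 * ‖t‖ ^ (d + 1)) = A * C2 * ‖t‖ ^ (α - γ) := by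
    rw [← hc, Real.rpow_add hT c (d + 1)]; ring
  have m3 : A * ‖t‖ ^ e * (C3 * ‖t‖ ^ (g + 1)) = A * C3 * ‖t‖ ^ (α - γ) := by
    rw [← he, Real.rpow_add hT e (g + 1)]; ring
  have n1 := mul_le_mul_of_nonneg_left j1 (by positivity : 0 ≤ A * ‖t‖ ^ a)
  have n2 := mul_le_mul_of_nonneg_left j2 (by positivity : 0 ≤ A * ‖t‖ ^ c)
  have n3 := mul_le_mul_of_nonneg_left j3 (by positivity : 0 ≤ A * ‖t‖ ^ e)
  have : A * (C1 + C2 + C3) * ‖t‖ ^ (α - γ) = A * C1 * ‖t‖ ^ (α - γ) + A * C2 * ‖t‖ ^ (α - γ)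
    + A * C3 * ‖t‖ ^ (α - γ) := by ring
  linarith

end helpers

/-- uniqueness of the local mild solution on a sufficiently small ball. -/
theorem local_mild_solution_unique (p : ℕ) [Fact p.Prime] (α γ : ℝ)
    (hα : 0 < α) (hγ0 : 0 < γ) (hγ : γ < min 1 α) (u₀ M F : ℝ) (f : ℤ → ℝ → ℝ)
    (hM : ∀ (ℓ : ℤ) (x : ℝ), |f ℓ x| ≤ M)
    (hF : ∀ (ℓ : ℤ) (x y : ℝ), |f ℓ x - f ℓ y| ≤ F * |x - y|)
    (N : ℤ) (u ubar : ℚ_[p] → ℝ) (hu : Radial p u) (hubar : Radial p ubar)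
    (hu0 : u 0 = u₀) (hubar0 : ubar 0 = u₀)
    (heq : ∀ t : ℚ_[p], t ≠ 0 → ‖t‖ ≤ (p : ℝ) ^ N →
      IntegrableOn (fun y => Iker p α t y * (‖y‖ ^ (-γ) * f (-y.valuation) (u y)))
        {y : ℚ_[p] | ‖y‖ ≤ ‖t‖} (padicHaar p) ∧
      u t = u₀ + Iop p α (fun y => ‖y‖ ^ (-γ) * f (-y.valuation) (u y)) t)
    (heqbar : ∀ t : ℚ_[p], t ≠ 0 → ‖t‖ ≤ (p : ℝ) ^ N →
      IntegrableOn (fun y => Iker p α t y * (‖y‖ ^ (-γ) * f (-y.valuation) (ubar y)))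
        {y : ℚ_[p] | ‖y‖ ≤ ‖t‖} (padicHaar p) ∧
      ubar t = u₀ + Iop p α (fun y => ‖y‖ ^ (-γ) * f (-y.valuation) (ubar y)) t) :
    ∃ K : ℤ, K ≤ N ∧ ∀ t : ℚ_[p], ‖t‖ ≤ (p : ℝ) ^ K → u t = ubar t := by
  have hp1 : (1 : ℝ) < p := by exact_mod_cast (Fact.out : p.Prime).one_lt
  have hp0 : (0 : ℝ) < p := by linarith
  obtain ⟨C, hC, hmain⟩ := main_bound p α γ hα hγ0 hγ
  have hγα : 0 < α - γ := sub_pos.2 (hγ.trans_le (min_le_right _ _))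
  have hdiff : ∀ t : ℚ_[p], t ≠ 0 → ‖t‖ ≤ 1 → ‖t‖ ≤ (p : ℝ) ^ N → ∀ D : ℝ,
      (∀ y : ℚ_[p], ‖y‖ ≤ ‖t‖ → |f (-y.valuation) (u y) - f (-y.valuation) (ubar y)| ≤ D) →
      |u t - ubar t| ≤ |Icoef p α| * (D * (C * ‖t‖ ^ (α - γ))) := by
    intro t ht ht1 htN D hD
    obtain ⟨a1, a2⟩ := heq t ht htN
    obtain ⟨b1, b2⟩ := heqbar t ht htN
    have e : u t - ubar t = Icoef p α * ∫ y in {y : ℚ_[p] | ‖y‖ ≤ ‖t‖}, Iker p α t y *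
        (‖y‖ ^ (-γ) * (f (-y.valuation) (u y) - f (-y.valuation) (ubar y))) ∂(padicHaar p) := by
      rw [a2, b2]
      simp only [Iop]
      rw [add_sub_add_left_eq_sub, ← mul_sub, ← integral_sub a1 b1]
      congr 2; ext y; ring
    rw [e, abs_mul]
    exact mul_le_mul_of_nonneg_left (hmain t ht ht1 D _ hD) (abs_nonneg _)
  -- choose a small radius
  set G : ℝ := |Icoef p α| * (|F| * C) with hG
  have hG0 : 0 ≤ G := by positivity
  have hlim : Filter.Tendsto (fun n : ℕ => G * ((p : ℝ) ^ (-(α - γ))) ^ n) Filter.atTop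
      (nhds (G * 0)) :=
    (tendsto_pow_atTop_nhds_zero_of_lt_one (by positivity)
      (Real.rpow_lt_one_of_one_lt_of_neg hp1 (by linarith))).const_mul G
  rw [mul_zero] at hlim
  obtain ⟨n, hn, hnN⟩ := ((hlim.eventually (gt_mem_nhds (by norm_num : (0 : ℝ) < 1 / 2))).and
    (Filter.eventually_ge_atTop (-N).toNat)).exists
  have hKN : -(n : ℤ) ≤ N := by omega
  refine ⟨-(n : ℤ), hKN, ?_⟩
  have hKN' : (p : ℝ) ^ (-(n : ℤ)) ≤ (p : ℝ) ^ N := zpow_le_zpow_right₀ hp1.le hKN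
  have hK1 : (p : ℝ) ^ (-(n : ℤ)) ≤ 1 := zpow_le_one_of_nonpos₀ hp1.le (by omega)
  have hpow : ∀ t : ℚ_[p], ‖t‖ ≤ (p : ℝ) ^ (-(n : ℤ)) →
      ‖t‖ ^ (α - γ) ≤ ((p : ℝ) ^ (-(α - γ))) ^ n := by
    intro t ht
    refine (Real.rpow_le_rpow (norm_nonneg _) ht hγα.le).trans_eq ?_
    rw [← Real.rpow_natCast, ← Real.rpow_intCast, ← Real.rpow_mul hp0.le, ← Real.rpow_mul hp0.le]
    congr 1; push_cast; ring
  have hM0 : 0 ≤ M := (abs_nonneg _).trans (hM 0 0)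
  set B : ℝ := |Icoef p α| * (2 * M * C) with hB
  have hB0 : 0 ≤ B := by positivity
  have hiter : ∀ m : ℕ, ∀ t : ℚ_[p], ‖t‖ ≤ (p : ℝ) ^ (-(n : ℤ)) →
      |u t - ubar t| ≤ B * (1 / 2) ^ m := by
    intro m
    induction m with
    | zero =>
      intro t ht
      by_cases h0 : t = 0
      · rw [h0, hu0, hubar0]; simpa using hB0
      · have h1 := hdiff t h0 (ht.trans hK1) (ht.trans hKN') (2 * M) (fun y _ => by
          refine (abs_sub _ _).trans ?_
          have := hM (-y.valuation) (u y)
          have := hM (-y.valuation) (ubar y)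
          linarith)
        have h2 : ‖t‖ ^ (α - γ) ≤ 1 := Real.rpow_le_one (norm_nonneg _) (ht.trans hK1) hγα.le
        have h3 := mul_le_mul_of_nonneg_left h2 hB0
        rw [pow_zero]
        calc _ ≤ _ := h1
          _ = B * ‖t‖ ^ (α - γ) := by rw [hB]; ring
          _ ≤ _ := h3
    | succ m ih =>
      intro t ht
      by_cases h0 : t = 0
      · rw [h0, hu0, hubar0]; simp only [sub_self, abs_zero]; positivity
      · have h1 := hdiff t h0 (ht.trans hK1) (ht.trans hKN') (|F| * (B * (1 / 2) ^ m))
          (fun y hy => by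
            refine (hF _ _ _).trans ?_
            exact mul_le_mul (le_abs_self F) (ih y (hy.trans ht)) (abs_nonneg _) (abs_nonneg _))
        have h2 : G * ‖t‖ ^ (α - γ) ≤ 1 / 2 :=
          (mul_le_mul_of_nonneg_left (hpow t ht) hG0).trans hn.le
        have h3 := mul_le_mul_of_nonneg_left h2 (by positivity : 0 ≤ B * (1 / 2 : ℝ) ^ m)
        calc _ ≤ _ := h1
          _ = B * (1 / 2) ^ m * (G * ‖t‖ ^ (α - γ)) := by rw [hG]; ring
          _ ≤ _ := h3
          _ = _ := by ring
  intro t ht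
  have hl : Filter.Tendsto (fun m : ℕ => B * (1 / 2 : ℝ) ^ m) Filter.atTop (nhds (B * 0)) :=
    (tendsto_pow_atTop_nhds_zero_of_lt_one (by norm_num) (by norm_num)).const_mul B
  rw [mul_zero] at hl
  have := ge_of_tendsto' hl fun m => hiter m t ht
  exact sub_eq_zero.1 (abs_nonpos_iff.1 this)
end
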